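/- arXiv:2407.02551 — 4 statements merged into one kernel-verified Lean document; each statement's English description precedes it below -/
import Mathlib

section
/- Non-negativity of restricted mutual information: for all finite nonempty types 𝒜 and ℬ, every strictly positive joint probability mass function p on 𝒜 × ℬ, and every subset T ⊆ 𝒜, the restricted mutual information satisfies I_T(𝒜;ℬ) ≥ 0. -/
/-- A pointwise form of Gibbs' inequality. -/
theorem Real.sub_le_mul_log_div {x y : ℝ} (hx : 0 < x) (hy : 0 < y) :
    x - y ≤ x * Real.log (x / y) := by
  have h := mul_le_mul_of_nonneg_left (Real.one_sub_inv_le_log_of_pos (div_pos hx hy)) hx.le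
  have e : x * (1 - (x / y)⁻¹) = x - y := by field_simp
  rwa [e] at h

/-- **Gibbs' inequality** for positive weights, where the reference weight has no larger mass. -/
theorem Finset.sum_mul_log_div_nonneg {ι : Type*} (s : Finset ι) {f g : ι → ℝ}
    (hf : ∀ i ∈ s, 0 < f i) (hg : ∀ i ∈ s, 0 < g i) (hfg : ∑ i ∈ s, g i ≤ ∑ i ∈ s, f i) :
    0 ≤ ∑ i ∈ s, f i * Real.log (f i / g i) :=
  calc 0 ≤ ∑ i ∈ s, (f i - g i) := by rw [Finset.sum_sub_distrib]; linarith
    _ ≤ _ := Finset.sum_le_sum fun i hi => Real.sub_le_mul_log_div (hf i hi) (hg i hi)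

/-- **Non-negativity of restricted mutual information.**
For finite nonempty types `𝒜`, `ℬ`, a strictly positive joint pmf `p` on `𝒜 × ℬ`,
and a subset `T ⊆ 𝒜`, the restricted mutual information
`I_T(𝒜;ℬ) = Σ_{a ∈ T} Σ_b p(a,b) · log( p(a,b) / (p_𝒜(a) · p_ℬ(b)) )` is non-negative. -/
theorem restricted_mutual_information_nonneg
    {𝒜 ℬ : Type*} [Fintype 𝒜] [Fintype ℬ] [Nonempty 𝒜] [Nonempty ℬ]
    (p : 𝒜 × ℬ → ℝ) (hpos : ∀ x, 0 < p x) (hsum : ∑ x, p x = 1)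
    (T : Finset 𝒜) :
    0 ≤ ∑ a ∈ T, ∑ b, p (a, b) *
        Real.log (p (a, b) / ((∑ b', p (a, b')) * (∑ a', p (a', b)))) := by
  have hB : ∑ b, ∑ a, p (a, b) = 1 := by rw [← hsum, Fintype.sum_prod_type_right]
  refine Finset.sum_nonneg fun a _ => Finset.sum_mul_log_div_nonneg _ (fun b _ => hpos _)
    (fun b _ => mul_pos ?_ ?_) ?_
  · exact Finset.sum_pos (fun _ _ => hpos _) Finset.univ_nonempty
  · exact Finset.sum_pos (fun _ _ => hpos _) Finset.univ_nonempty
  · rw [← Finset.mul_sum, hB, mul_one]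
end

section
/- Data processing inequality for restricted mutual information: for all finite nonempty types 𝒞, ℋ, ℋ′, every strictly positive joint probability mass function p on 𝒞 × ℋ × ℋ′ satisfying the conditional-independence (Markov) condition p(c,h,h′) · p_ℋ(h) = p_{𝒞ℋ}(c,h) · p_{ℋℋ′}(h,h′) for all (c,h,h′), and every subset T ⊆ 𝒞, one has I_T(𝒞; ℋ′) ≤ I_T(𝒞; ℋ). -/
/-- Data processing for a single value of the source: `f` is the joint mass of that value, `q` the
joint marginal of the two observations, and `s` the mass of the value. -/
theorem sum_mul_log_marginal_le {α β : Type*} [Fintype α] [Fintype β] [Nonempty α] [Nonempty β]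
    (f q : α → β → ℝ) (s : ℝ) (hf : ∀ a b, 0 < f a b) (hq : ∀ a b, 0 < q a b) (hs : 0 < s)
    (hfq : ∀ a b, f a b * ∑ b', q a b' = (∑ b', f a b') * q a b) :
    ∑ b, (∑ a, f a b) * Real.log ((∑ a, f a b) / (s * ∑ a, q a b))
      ≤ ∑ a, (∑ b, f a b) * Real.log ((∑ b, f a b) / (s * ∑ b, q a b)) := by
  have hfα : ∀ b, 0 < ∑ a, f a b := fun b ↦ Finset.sum_pos (fun a _ ↦ hf a b) Finset.univ_nonempty
  have hfβ : ∀ a, 0 < ∑ b, f a b := fun a ↦ Finset.sum_pos (fun b _ ↦ hf a b) Finset.univ_nonempty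
  have hqα : ∀ b, 0 < ∑ a, q a b := fun b ↦ Finset.sum_pos (fun a _ ↦ hq a b) Finset.univ_nonempty
  have hqβ : ∀ a, 0 < ∑ b, q a b := fun a ↦ Finset.sum_pos (fun b _ ↦ hq a b) Finset.univ_nonempty
  have pointwise (a : α) (b : β) :
      f a b * Real.log ((∑ a, f a b) / (s * ∑ a, q a b))
        ≤ f a b * Real.log ((∑ b, f a b) / (s * ∑ b, q a b))
          + (q a b * ((∑ a, f a b) / ∑ a, q a b) - f a b) := by
    have hA : 0 < (∑ a, f a b) / (s * ∑ a, q a b) := div_pos (hfα b) (mul_pos hs (hqα b))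
    have hB : 0 < (∑ b, f a b) / (s * ∑ b, q a b) := div_pos (hfβ a) (mul_pos hs (hqβ a))
    have hlog := Real.log_le_sub_one_of_pos (div_pos hA hB)
    rw [Real.log_div hA.ne' hB.ne'] at hlog
    have hratio : f a b * (((∑ a, f a b) / (s * ∑ a, q a b)) / ((∑ b, f a b) / (s * ∑ b, q a b)))
        = q a b * ((∑ a, f a b) / ∑ a, q a b) := by
      have h₁ := (hfα b).ne'
      have h₂ := (hfβ a).ne'
      have h₃ := (hqα b).ne'
      have h₄ := (hqβ a).ne'
      have h₅ := hs.ne'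
      field_simp
      linear_combination hfq a b
    have := mul_le_mul_of_nonneg_left hlog (hf a b).le
    linarith
  have hcancel : ∑ b, ∑ a, (q a b * ((∑ a, f a b) / ∑ a, q a b) - f a b) = 0 := by
    refine Finset.sum_eq_zero fun b _ ↦ ?_
    rw [Finset.sum_sub_distrib, ← Finset.sum_mul, mul_div_cancel₀ _ (hqα b).ne', sub_self]
  calc
    _ = ∑ b, ∑ a, f a b * Real.log ((∑ a, f a b) / (s * ∑ a, q a b)) := by
      simp only [Finset.sum_mul]
    _ ≤ ∑ b, ∑ a, (f a b * Real.log ((∑ b, f a b) / (s * ∑ b, q a b))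
          + (q a b * ((∑ a, f a b) / ∑ a, q a b) - f a b)) :=
      Finset.sum_le_sum fun b _ ↦ Finset.sum_le_sum fun a _ ↦ pointwise a b
    _ = ∑ b, ∑ a, f a b * Real.log ((∑ b, f a b) / (s * ∑ b, q a b)) := by
      simp only [Finset.sum_add_distrib, hcancel, add_zero]
    _ = _ := by
      rw [Finset.sum_comm]
      simp only [Finset.sum_mul]


/-- **Data processing inequality for restricted mutual information.**
For finite nonempty types `𝒞`, `ℋ`, `ℋ'`, a strictly positive joint pmf `p` on `𝒞 × ℋ × ℋ'`
satisfying the Markov condition `p(c,h,h') · p_ℋ(h) = p_{𝒞ℋ}(c,h) · p_{ℋℋ'}(h,h')`,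
and a subset `T ⊆ 𝒞`, one has `I_T(𝒞; ℋ') ≤ I_T(𝒞; ℋ)`. -/
theorem restricted_mutual_information_data_processing
    {𝒞 ℋ ℋ' : Type*} [Fintype 𝒞] [Fintype ℋ] [Fintype ℋ']
    [Nonempty 𝒞] [Nonempty ℋ] [Nonempty ℋ']
    (p : 𝒞 × ℋ × ℋ' → ℝ) (hpos : ∀ x, 0 < p x) (hsum : ∑ x, p x = 1)
    (hmarkov : ∀ c h h', p (c, h, h') * (∑ c', ∑ h'', p (c', h, h''))
        = (∑ h'', p (c, h, h'')) * (∑ c', p (c', h, h')))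
    (T : Finset 𝒞) :
    (∑ c ∈ T, ∑ h' : ℋ', (∑ h, p (c, h, h')) *
        Real.log ((∑ h, p (c, h, h')) /
          ((∑ h, ∑ h'', p (c, h, h'')) * (∑ c', ∑ h, p (c', h, h')))))
      ≤ ∑ c ∈ T, ∑ h : ℋ, (∑ h', p (c, h, h')) *
          Real.log ((∑ h', p (c, h, h')) /
            ((∑ h'', ∑ h', p (c, h'', h')) * (∑ c', ∑ h', p (c', h, h')))) := by
  refine Finset.sum_le_sum fun c _ ↦ ?_
  have h := sum_mul_log_marginal_le (fun h h' ↦ p (c, h, h')) (fun h h' ↦ ∑ c', p (c', h, h'))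
    (∑ h, ∑ h', p (c, h, h')) (fun _ _ ↦ hpos _)
    (fun _ _ ↦ Finset.sum_pos (fun _ _ ↦ hpos _) Finset.univ_nonempty)
    (Finset.sum_pos (fun _ _ ↦ Finset.sum_pos (fun _ _ ↦ hpos _) Finset.univ_nonempty)
      Finset.univ_nonempty)
    (fun h h' ↦ by rw [Finset.sum_comm]; exact hmarkov c h h')
  simpa only [Finset.sum_comm (s := (Finset.univ : Finset 𝒞))] using h
end

section
/- Randomised response is an ε-information-censorship mechanism (Theorem 2): let 𝒴 and 𝒜 be finite nonempty types, S ⊆ 𝒴 a nonempty subset, T ⊆ 𝒜 a subset, ε > 0, and let ι be a finite nonempty index type with, for each i ∈ ι: a strictly positive prior π_i on 𝒜, a family ρ_i : 𝒴 → (𝒜 → ℝ) of strictly positive probability mass functions on 𝒜, and a victim response distribution v_i on 𝒴 with v_i(s) = 0 for all s ∈ S. Define the leakage L_i(r) = Σ_{y ∈ 𝒴} r(y) · Σ_{a ∈ T} ρ_i(y)(a) · Real.log( ρ_i(y)(a) / π_i(a) ) for any response distribution r, and suppose every safe string leaks nothing: Σ_{a ∈ T} ρ_i(s)(a) · Real.log(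 ρ_i(s)(a) / π_i(a) ) = 0 for all i ∈ ι and s ∈ S. Let L* = max_{i ∈ ι} L_i(v_i), assume L* > 0, and set t_ε = min( ε / L*, 1 ). Then for every i ∈ ι, the randomised response mechanism m_i with parameter t_ε, given by m_i(y) = t_ε · v_i(y) for y ∉ S and m_i(y) = (1 − t_ε)/|S| for y ∈ S, satisfies L_i(m_i) ≤ ε. -/
/-- The impermissible information leakage of a response distribution `r` on `𝒴` to an
adversary with prior `π` and posteriors `ρ y` after each response `y`, restricted to the
impermissible set `T`:  `L(r) = Σ_y r(y) · Σ_{a ∈ T} ρ(y)(a) · log( ρ(y)(a) / π(a) )`. -/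
noncomputable def leakage {𝒴 𝒜 : Type*} [Fintype 𝒴] [Fintype 𝒜]
    (T : Finset 𝒜) (π : 𝒜 → ℝ) (ρ : 𝒴 → 𝒜 → ℝ) (r : 𝒴 → ℝ) : ℝ :=
  ∑ y, r y * ∑ a ∈ T, ρ y a * Real.log (ρ y a / π a)

/-- A mechanism that scales `r` by `t` outside a set of responses leaking nothing, and is
constant on that set, has `t` times the leakage of `r`. -/
theorem leakage_ite_const {𝒴 𝒜 : Type*} [Fintype 𝒴] [Fintype 𝒜] [DecidableEq 𝒴]
    {S : Finset 𝒴} {T : Finset 𝒜} {π : 𝒜 → ℝ} {ρ : 𝒴 → 𝒜 → ℝ}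
    (hsafe : ∀ y ∈ S, ∑ a ∈ T, ρ y a * Real.log (ρ y a / π a) = 0) (r : 𝒴 → ℝ) (c t : ℝ) :
    leakage T π ρ (fun y => if y ∈ S then c else t * r y) = t * leakage T π ρ r := by
  unfold leakage
  rw [Finset.mul_sum]
  refine Finset.sum_congr rfl fun y _ => ?_
  by_cases hy : y ∈ S
  · rw [hsafe y hy]; simp
  · simp only [if_neg hy, mul_assoc]

/-- **Randomised response is an ε-information-censorship mechanism (Theorem 2).**
With `L* = max_i L_i(v_i) > 0` and `t_ε = min(ε / L*, 1)`, every randomised response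
mechanism `m_i` with parameter `t_ε` (returning a uniform safe string with probability
`1 − t_ε`) satisfies `L_i(m_i) ≤ ε`, provided safe strings leak nothing. -/
theorem randomised_response_is_epsilon_ICM
    {𝒴 𝒜 ι : Type*} [Fintype 𝒴] [Fintype 𝒜] [Fintype ι]
    [Nonempty 𝒴] [Nonempty 𝒜] [Nonempty ι] [DecidableEq 𝒴]
    (S : Finset 𝒴) (hS : S.Nonempty) (T : Finset 𝒜) (ε : ℝ) (hε : 0 < ε)
    (π : ι → 𝒜 → ℝ) (hπpos : ∀ i a, 0 < π i a) (hπsum : ∀ i, ∑ a, π i a = 1)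
    (ρ : ι → 𝒴 → 𝒜 → ℝ) (hρpos : ∀ i y a, 0 < ρ i y a) (hρsum : ∀ i y, ∑ a, ρ i y a = 1)
    (v : ι → 𝒴 → ℝ) (hvnn : ∀ i y, 0 ≤ v i y) (hvsum : ∀ i, ∑ y, v i y = 1)
    (hvS : ∀ i, ∀ y ∈ S, v i y = 0)
    (hsafe : ∀ i, ∀ y ∈ S, ∑ a ∈ T, ρ i y a * Real.log (ρ i y a / π i a) = 0)
    (Lstar : ℝ)
    (hLstar : Lstar = Finset.univ.sup' Finset.univ_nonempty
        (fun i : ι => leakage T (π i) (ρ i) (v i)))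
    (hLpos : 0 < Lstar)
    (tε : ℝ) (htε : tε = min (ε / Lstar) 1) :
    ∀ i : ι, leakage T (π i) (ρ i)
        (fun y => if y ∈ S then (1 - tε) / (S.card : ℝ) else tε * v i y) ≤ ε := by
  intro i
  rw [leakage_ite_const (hsafe i)]
  have hle : leakage T (π i) (ρ i) (v i) ≤ Lstar :=
    hLstar ▸ Finset.le_sup' (fun i : ι => leakage T (π i) (ρ i) (v i)) (Finset.mem_univ i)
  have ht : 0 ≤ tε := htε ▸ le_min (div_pos hε hLpos).le zero_le_one
  calc tε * leakage T (π i) (ρ i) (v i) ≤ tε * Lstar := mul_le_mul_of_nonneg_left hle ht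
    _ ≤ ε / Lstar * Lstar :=
      mul_le_mul_of_nonneg_right (htε ▸ min_le_left _ _) hLpos.le
    _ = ε := div_mul_cancel₀ ε hLpos.ne'
end

section
/- Utility bound for inferential users (Theorem 4): let 𝒰, 𝒱, 𝒴 be finite nonempty types, p a strictly positive joint probability mass function on 𝒰 × 𝒱 × 𝒴, T ⊆ 𝒱 a subset, and ε ≥ 0. If the restricted mutual information between the adversary variable and the response satisfies I_T(𝒱; 𝒴) ≤ ε, then the (unrestricted) mutual information between the benign user variable and the response satisfies I(𝒰; 𝒴) ≤ ε + H(𝒰 | 𝒱) + I_{Tᶜ}(𝒱; 𝒴), where Tᶜ is the complement of T in 𝒱. -/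
/-- Pointwise estimate behind `I(U; Y) ≤ I(V; Y) + H(U | V)`: with `q` the joint mass of
`(u, v, y)` and `quv`, `qvy`, `quy`, `qu`, `qv`, `qy` the marginal masses. -/
lemma mul_log_marginals_le {q quv qvy quy qu qv qy : ℝ} (hq : 0 < q) (huv : 0 < quv)
    (hvy : 0 < qvy) (huy : 0 < quy) (hu : 0 < qu) (hv : 0 < qv) (hy : 0 < qy) (hle : q ≤ qvy) :
    q * Real.log (quy / (qu * qy)) + q * Real.log (quv / qv)
      - q * Real.log (qvy / (qv * qy)) ≤ quv * quy / qu - q := by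
  have hlog : Real.log (quy / (qu * qy)) + Real.log (quv / qv) - Real.log (qvy / (qv * qy))
      = Real.log (quv * quy / qu / qvy) := by
    rw [← Real.log_mul (by positivity) (by positivity),
      ← Real.log_div (by positivity) (by positivity)]
    congr 1
    field_simp
  have hbound := mul_le_mul_of_nonneg_left
    (Real.log_le_sub_one_of_pos (x := quv * quy / qu / qvy) (by positivity)) hq.le
  have hfrac : q * (quv * quy / qu / qvy) ≤ quv * quy / qu := by
    rw [mul_div_assoc', div_le_iff₀ hvy, mul_comm]
    gcongr
  rw [← hlog] at hbound
  linarith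

/-- Mutual information satisfies `I(U; Y) ≤ I(V; Y) + H(U | V)` for strictly positive masses. -/
lemma mutualInfo_le_mutualInfo_add_condEntropy {U V Y : Type*} [Fintype U] [Fintype V] [Fintype Y]
    [Nonempty U] [Nonempty V] [Nonempty Y] (p : U × V × Y → ℝ) (hpos : ∀ x, 0 < p x) :
    (∑ u, ∑ y, (∑ v, p (u, v, y)) *
        Real.log ((∑ v, p (u, v, y)) /
          ((∑ v, ∑ y', p (u, v, y')) * (∑ u', ∑ v, p (u', v, y)))))
      ≤ (∑ v, ∑ y, (∑ u, p (u, v, y)) *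
          Real.log ((∑ u, p (u, v, y)) /
            ((∑ u, ∑ y', p (u, v, y')) * (∑ u, ∑ v', p (u, v', y)))))
        + (-∑ u, ∑ v, (∑ y, p (u, v, y)) *
            Real.log ((∑ y, p (u, v, y)) / (∑ u', ∑ y', p (u', v, y')))) := by
  have huv : ∀ u v, 0 < ∑ y, p (u, v, y) := fun u v =>
    Finset.sum_pos (fun _ _ => hpos _) Finset.univ_nonempty
  have hvy : ∀ v y, 0 < ∑ u, p (u, v, y) := fun v y =>
    Finset.sum_pos (fun _ _ => hpos _) Finset.univ_nonempty
  have huy : ∀ u y, 0 < ∑ v, p (u, v, y) := fun u y =>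
    Finset.sum_pos (fun _ _ => hpos _) Finset.univ_nonempty
  have hu : ∀ u, 0 < ∑ v, ∑ y, p (u, v, y) := fun u =>
    Finset.sum_pos (fun _ _ => huv _ _) Finset.univ_nonempty
  have hv : ∀ v, 0 < ∑ u, ∑ y, p (u, v, y) := fun v =>
    Finset.sum_pos (fun _ _ => huv _ _) Finset.univ_nonempty
  have hy : ∀ y, 0 < ∑ u, ∑ v, p (u, v, y) := fun y =>
    Finset.sum_pos (fun _ _ => huy _ _) Finset.univ_nonempty
  have key := Finset.sum_le_sum fun u (_ : u ∈ Finset.univ) =>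
    Finset.sum_le_sum fun v (_ : v ∈ Finset.univ) =>
      Finset.sum_le_sum fun y (_ : y ∈ Finset.univ) =>
        mul_log_marginals_le (hpos (u, v, y)) (huv u v) (hvy v y) (huy u y) (hu u) (hv v) (hy y)
          (Finset.single_le_sum (f := fun u => p (u, v, y)) (fun _ _ => (hpos _).le)
            (Finset.mem_univ u))
  have hmass : ∑ u, ∑ v, ∑ y, (∑ y', p (u, v, y')) * (∑ v', p (u, v', y))
      / (∑ v', ∑ y', p (u, v', y')) = ∑ u, ∑ v, ∑ y, p (u, v, y) := by
    refine Finset.sum_congr rfl fun u _ => ?_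
    simp_rw [← Finset.sum_div, ← Finset.mul_sum]
    rw [← Finset.sum_mul, Finset.sum_comm (f := fun y v => p (u, v, y))]
    exact mul_div_cancel_right₀ _ (hu u).ne'
  simp only [Finset.sum_sub_distrib, Finset.sum_add_distrib] at key
  rw [hmass, sub_self] at key
  have hUY (g : U → Y → ℝ) : ∑ u, ∑ y, (∑ v, p (u, v, y)) * g u y
      = ∑ u, ∑ v, ∑ y, p (u, v, y) * g u y := by
    simp_rw [Finset.sum_mul]
    exact Finset.sum_congr rfl fun u _ => Finset.sum_comm
  have hVY (g : V → Y → ℝ) : ∑ v, ∑ y, (∑ u, p (u, v, y)) * g v y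
      = ∑ u, ∑ v, ∑ y, p (u, v, y) * g v y := by
    simp_rw [Finset.sum_mul]
    rw [Finset.sum_comm (s := (Finset.univ : Finset U))]
    exact Finset.sum_congr rfl fun v _ => Finset.sum_comm
  have hUV (g : U → V → ℝ) : ∑ u, ∑ v, (∑ y, p (u, v, y)) * g u v
      = ∑ u, ∑ v, ∑ y, p (u, v, y) * g u v := by
    simp_rw [Finset.sum_mul]
  rw [hUY fun u y => Real.log _, hVY fun v y => Real.log _, hUV fun u v => Real.log _]
  linarith

/-- **Utility bound for inferential users (Theorem 4).**
Let `𝒰`, `𝒱`, `𝒴` be finite nonempty types, `p` a strictly positive joint pmf on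
`𝒰 × 𝒱 × 𝒴`, `T ⊆ 𝒱`, and `ε ≥ 0`.  If the restricted mutual information between the
adversary variable and the response satisfies `I_T(𝒱; 𝒴) ≤ ε`, then
`I(𝒰; 𝒴) ≤ ε + H(𝒰 | 𝒱) + I_{Tᶜ}(𝒱; 𝒴)`. -/
theorem utility_bound_for_inferential_users
    {𝒰 𝒱 𝒴 : Type*} [Fintype 𝒰] [Fintype 𝒱] [Fintype 𝒴]
    [Nonempty 𝒰] [Nonempty 𝒱] [Nonempty 𝒴] [DecidableEq 𝒱]
    (p : 𝒰 × 𝒱 × 𝒴 → ℝ) (hpos : ∀ x, 0 < p x) (hsum : ∑ x, p x = 1)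
    (T : Finset 𝒱) (ε : ℝ) (hε : 0 ≤ ε)
    (hadv : (∑ v ∈ T, ∑ y, (∑ u, p (u, v, y)) *
        Real.log ((∑ u, p (u, v, y)) /
          ((∑ u, ∑ y', p (u, v, y')) * (∑ u, ∑ v', p (u, v', y))))) ≤ ε) :
    (∑ u, ∑ y, (∑ v, p (u, v, y)) *
        Real.log ((∑ v, p (u, v, y)) /
          ((∑ v, ∑ y', p (u, v, y')) * (∑ u', ∑ v, p (u', v, y)))))
      ≤ ε
        + (-∑ u, ∑ v, (∑ y, p (u, v, y)) *
            Real.log ((∑ y, p (u, v, y)) / (∑ u', ∑ y', p (u', v, y'))))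
        + (∑ v ∈ Tᶜ, ∑ y, (∑ u, p (u, v, y)) *
            Real.log ((∑ u, p (u, v, y)) /
              ((∑ u, ∑ y', p (u, v, y')) * (∑ u, ∑ v', p (u, v', y))))) := by
  have hmain := mutualInfo_le_mutualInfo_add_condEntropy p hpos
  rw [← Finset.sum_add_sum_compl T] at hmain
  linarith
end
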